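/- There is an absolute constant C such that for every weight ω on ℝ with [ω]_{A₂} < ∞ and every J ∈ 𝒟: ∑_{I∈𝒟, I⊆J} |⟨ω^{-1}, h_I⟩ ⟨ω, h_{I₋}⟩| ≤ C [ω]_{A₂} |J|. -/

import Mathlib

open MeasureTheory ENNReal NNReal

noncomputable section

/-- The dyadic interval `[2^n k, 2^n (k+1))`, encoded by the pair `p = (n, k)`. -/
def dyad (p : ℤ × ℤ) : Set ℝ := Set.Ico ((2:ℝ) ^ p.1 * p.2) ((2:ℝ) ^ p.1 * (p.2 + 1))

/-- The length `2^n` of the dyadic interval encoded by `p = (n, k)`. -/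
def len (p : ℤ × ℤ) : ℝ := (2:ℝ) ^ p.1

/-- The left half `I₋` of the dyadic interval. -/
def lhalf (p : ℤ × ℤ) : ℤ × ℤ := (p.1 - 1, 2 * p.2)

/-- The right half `I₊` of the dyadic interval. -/
def rhalf (p : ℤ × ℤ) : ℤ × ℤ := (p.1 - 1, 2 * p.2 + 1)

/-- The average `⟨f⟩_I = |I|⁻¹ ∫_I f` over the dyadic interval `p`. -/
def avg (f : ℝ → ℝ) (p : ℤ × ℤ) : ℝ := (len p)⁻¹ * ∫ x in dyad p, f x

/-- The Haar function `h_I = |I|^{-1/2} (1_{I₋} - 1_{I₊})`. -/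
def haar (p : ℤ × ℤ) : ℝ → ℝ := fun x =>
  (Real.sqrt (len p))⁻¹ *
    ((dyad (lhalf p)).indicator (fun _ => (1:ℝ)) x -
      (dyad (rhalf p)).indicator (fun _ => (1:ℝ)) x)

/-- The Haar coefficient `⟨f, h_I⟩ = ∫ f h_I`. -/
def haarCoeff (f : ℝ → ℝ) (p : ℤ × ℤ) : ℝ := ∫ x, f x * haar p x

/-- The A₂ characteristic `[ω]_{A₂} = sup_I ⟨ω⟩_I ⟨ω⁻¹⟩_I`, valued in `ℝ≥0∞`. -/
def A2 (ω : ℝ → ℝ) : ℝ≥0∞ :=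
  ⨆ p : ℤ × ℤ, ENNReal.ofReal (avg ω p * avg (fun x => (ω x)⁻¹) p)

/-- `ω` is a weight: measurable, positive, with `ω` and `ω⁻¹` locally integrable. -/
def IsWeight (ω : ℝ → ℝ) : Prop :=
  Measurable ω ∧ (∀ x, 0 < ω x) ∧
    LocallyIntegrable ω volume ∧ LocallyIntegrable (fun x => (ω x)⁻¹) volume

/-- The measure `ω dx`. -/
def wMeasure (ω : ℝ → ℝ) : Measure ℝ := volume.withDensity fun x => ENNReal.ofReal (ω x)

/-- `ω^{1/2}`. -/
def sqrtw (ω : ℝ → ℝ) : ℝ → ℝ := fun x => Real.sqrt (ω x)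

/-- `ω^{-1/2}`. -/
def invSqrtw (ω : ℝ → ℝ) : ℝ → ℝ := fun x => (Real.sqrt (ω x))⁻¹

lemma sqrt_one_add_le {s : ℝ} (h₁ : -1 ≤ s) (h₂ : s ≤ 1) :
    √(1 + s) ≤ 1 + s / 2 - s ^ 2 / 12 := by
  apply Real.sqrt_le_iff.mpr
  refine ⟨by nlinarith, ?_⟩
  have h : (1 + s / 2 - s ^ 2 / 12) ^ 2 - (1 + s) = s ^ 2 / 12 * (1 - s + s ^ 2 / 12) := by ring
  have : 0 ≤ s ^ 2 / 12 * (1 - s + s ^ 2 / 12) := by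
    have : 0 ≤ 1 - s := by linarith
    positivity
  linarith

lemma sqrt_sqrt_mul_le {u v s t : ℝ} (hu : 0 ≤ u) (hv : 0 ≤ v)
    (hs : |s| ≤ 1) (ht : |t| ≤ 1) :
    √√(u * (1 + s) * (v * (1 + t))) ≤
      √√(u * v) * (1 + (s + t) / 4 - (s ^ 2 + t ^ 2) / 24) := by
  obtain ⟨hs₁, hs₂⟩ := abs_le.mp hs
  obtain ⟨ht₁, ht₂⟩ := abs_le.mp ht
  have e : u * (1 + s) * (v * (1 + t)) = (u * v) * ((1 + s) * (1 + t)) := by ring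
  have hS := sqrt_one_add_le hs₁ hs₂
  have hT := sqrt_one_add_le ht₁ ht₂
  rw [e, Real.sqrt_mul (by positivity), Real.sqrt_mul (by positivity)]
  gcongr
  rw [Real.sqrt_mul (by linarith)]
  have h : √(√(1 + s) * √(1 + t)) ≤ (√(1 + s) + √(1 + t)) / 2 := by
    apply Real.sqrt_le_iff.mpr
    exact ⟨by positivity, by nlinarith [sq_nonneg (√(1 + s) - √(1 + t))]⟩
  linarith

/-- The Bellman function `(u v)^{1/4}` has a quantitative midpoint concavity. -/
lemma bellman_drop {u v s t R : ℝ} (hu : 0 ≤ u) (hv : 0 ≤ v) (hs : |s| ≤ 1) (ht : |t| ≤ 1)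
    (hR : √√(u * v) ≤ R) :
    u * v * (s ^ 2 + t ^ 2) ≤ 24 * R ^ 3 * (√√(u * v) -
      (√√(u * (1 + s) * (v * (1 + t))) + √√(u * (1 - s) * (v * (1 - t)))) / 2) := by
  have h₁ := sqrt_sqrt_mul_le hu hv hs ht
  have h₂ := sqrt_sqrt_mul_le (s := -s) (t := -t) hu hv (by simpa) (by simpa)
  simp only [← sub_eq_add_neg] at h₂
  set B := √√(u * v) with hB
  have hB0 : 0 ≤ B := by positivity
  have hB4 : u * v = B ^ 4 := by
    have h : B ^ 4 = (B ^ 2) ^ 2 := by ring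
    rw [h, hB, Real.sq_sqrt (by positivity), Real.sq_sqrt (by positivity)]
  have hdrop : B * (s ^ 2 + t ^ 2) / 24 ≤
      B - (√√(u * (1 + s) * (v * (1 + t))) + √√(u * (1 - s) * (v * (1 - t)))) / 2 := by
    linarith
  calc u * v * (s ^ 2 + t ^ 2) = B ^ 3 * (B * (s ^ 2 + t ^ 2)) := by rw [hB4]; ring
    _ ≤ R ^ 3 * (B * (s ^ 2 + t ^ 2)) := by gcongr
    _ = 24 * R ^ 3 * (B * (s ^ 2 + t ^ 2) / 24) := by ring
    _ ≤ _ := by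
      have : 0 ≤ R := hB0.trans hR
      gcongr

/-- The normalised difference `(a - b) / (a + b)`. -/
def relDiff (a b : ℝ) : ℝ := (a - b) / (a + b)

lemma abs_relDiff_le {a b : ℝ} (ha : 0 < a) (hb : 0 < b) : |relDiff a b| ≤ 1 := by
  rw [relDiff, abs_div, div_le_one (by positivity), abs_of_pos (add_pos ha hb), abs_le]
  constructor <;> linarith

lemma bellman_drop' {u₁ u₂ v₁ v₂ R : ℝ} (hu₁ : 0 < u₁) (hu₂ : 0 < u₂) (hv₁ : 0 < v₁)
    (hv₂ : 0 < v₂) (hR : √√((u₁ + u₂) / 2 * ((v₁ + v₂) / 2)) ≤ R) :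
    (u₁ + u₂) / 2 * ((v₁ + v₂) / 2) * (relDiff u₁ u₂ ^ 2 + relDiff v₁ v₂ ^ 2) ≤
      24 * R ^ 3 * (√√((u₁ + u₂) / 2 * ((v₁ + v₂) / 2)) -
        (√√(u₁ * v₁) + √√(u₂ * v₂)) / 2) := by
  have h := bellman_drop (by positivity) (by positivity) (abs_relDiff_le hu₁ hu₂)
    (abs_relDiff_le hv₁ hv₂) hR
  have e₁ : ∀ a b : ℝ, 0 < a → 0 < b → (a + b) / 2 * (1 + relDiff a b) = a := by
    intro a b ha hb; unfold relDiff; field_simp; ring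
  have e₂ : ∀ a b : ℝ, 0 < a → 0 < b → (a + b) / 2 * (1 - relDiff a b) = b := by
    intro a b ha hb; unfold relDiff; field_simp; ring
  rwa [e₁ _ _ hu₁ hu₂, e₂ _ _ hu₁ hu₂, e₁ _ _ hv₁ hv₂, e₂ _ _ hv₁ hv₂] at h

/-- The mixed-level term is controlled by square terms on the interval and on its left half. -/
lemma mixed_le {v v' u u' a b : ℝ} (hu : 0 ≤ u) (hv : 0 ≤ v) (hu' : 0 ≤ u') (hv' : 0 ≤ v')
    (hle : u' ≤ 2 * u) (hb : 0 ≤ b) (hb1 : b ≤ 1) (hav : v * (1 - a) ≤ v') :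
    v * a * (u' * b) ≤ 4 * (u * v * a ^ 2) + u' * v' * b ^ 2 := by
  rcases le_total (1 / 2) a with h | h
  · have : v * a * (u' * b) ≤ v * a * (2 * u * (2 * a)) := by
      gcongr
      linarith
    have : 0 ≤ u' * v' * b ^ 2 := by positivity
    nlinarith
  · have hvv : v ≤ 2 * v' := by nlinarith
    have h₁ : v * u' * a ^ 2 ≤ v * (2 * u) * a ^ 2 := by gcongr
    have h₂ : v * u' * b ^ 2 ≤ 2 * v' * u' * b ^ 2 := by gcongr
    have h₃ : 0 ≤ v * u' * (a - b) ^ 2 := by positivity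
    have h₄ : 0 ≤ u * v * a ^ 2 := by positivity
    nlinarith

lemma len_pos (p : ℤ × ℤ) : 0 < len p := by unfold len; positivity

lemma len_lhalf (p : ℤ × ℤ) : len (lhalf p) = len p / 2 := by
  simp [len, lhalf, zpow_sub_one₀, div_eq_mul_inv]

lemma len_rhalf (p : ℤ × ℤ) : len (rhalf p) = len p / 2 := by
  simp [len, rhalf, zpow_sub_one₀, div_eq_mul_inv]

lemma dyad_lhalf (p : ℤ × ℤ) :
    dyad (lhalf p) = Set.Ico (len p * p.2) (len p * p.2 + len p / 2) := by
  have := len_lhalf p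
  simp only [len] at this
  rw [show (lhalf p).1 = p.1 - 1 from rfl] at this
  simp only [dyad, len, lhalf, this]
  congr 1 <;> (push_cast; ring)

lemma dyad_rhalf (p : ℤ × ℤ) :
    dyad (rhalf p) = Set.Ico (len p * p.2 + len p / 2) (len p * (p.2 + 1)) := by
  have := len_rhalf p
  simp only [len] at this
  rw [show (rhalf p).1 = p.1 - 1 from rfl] at this
  simp only [dyad, len, rhalf, this]
  congr 1 <;> (push_cast; ring)

lemma dyad_eq_union (p : ℤ × ℤ) : dyad p = dyad (lhalf p) ∪ dyad (rhalf p) := by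
  have := len_pos p
  rw [dyad_lhalf, dyad_rhalf, Set.Ico_union_Ico_eq_Ico (by linarith) (by linarith)]
  rfl

lemma disjoint_halves (p : ℤ × ℤ) : Disjoint (dyad (lhalf p)) (dyad (rhalf p)) := by
  rw [dyad_lhalf, dyad_rhalf]
  exact Set.Ico_disjoint_Ico_same

lemma measurableSet_dyad (p : ℤ × ℤ) : MeasurableSet (dyad p) := measurableSet_Ico

lemma integrableOn_dyad {f : ℝ → ℝ} (hf : LocallyIntegrable f volume) (p : ℤ × ℤ) :
    IntegrableOn f (dyad p) :=
  (hf.integrableOn_isCompact isCompact_Icc).mono_set Set.Ico_subset_Icc_self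

lemma volume_dyad (p : ℤ × ℤ) : volume (dyad p) = ENNReal.ofReal (len p) := by
  rw [dyad, Real.volume_Ico]
  congr 1
  simp only [len]
  ring

lemma avg_pos {f : ℝ → ℝ} (hf : LocallyIntegrable f volume) (h : ∀ x, 0 < f x) (p : ℤ × ℤ) :
    0 < avg f p := by
  refine mul_pos (inv_pos.mpr (len_pos p)) ?_
  rw [setIntegral_pos_iff_support_of_nonneg_ae (ae_of_all _ fun x => (h x).le)
    (integrableOn_dyad hf p)]
  have : Function.support f = Set.univ := by
    ext x; simp [(h x).ne']
  rw [this, Set.univ_inter, volume_dyad]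
  simpa using len_pos p

lemma setIntegral_dyad (f : ℝ → ℝ) (p : ℤ × ℤ) : ∫ x in dyad p, f x = len p * avg f p := by
  rw [avg, mul_inv_cancel_left₀ (len_pos p).ne']

lemma avg_eq {f : ℝ → ℝ} (hf : LocallyIntegrable f volume) (p : ℤ × ℤ) :
    avg f p = (avg f (lhalf p) + avg f (rhalf p)) / 2 := by
  have h : ∫ x in dyad p, f x = (∫ x in dyad (lhalf p), f x) + ∫ x in dyad (rhalf p), f x := by
    rw [dyad_eq_union, setIntegral_union (disjoint_halves p) (measurableSet_dyad _)
      (integrableOn_dyad hf _) (integrableOn_dyad hf _)]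
  rw [setIntegral_dyad, setIntegral_dyad, setIntegral_dyad, len_lhalf, len_rhalf] at h
  exact mul_left_cancel₀ (len_pos p).ne' (by linarith)

lemma haarCoeff_eq {f : ℝ → ℝ} (hf : LocallyIntegrable f volume) (p : ℤ × ℤ) :
    haarCoeff f p = √(len p) / 2 * (avg f (lhalf p) - avg f (rhalf p)) := by
  have e : ∀ x, f x * haar p x = (√(len p))⁻¹ *
      ((dyad (lhalf p)).indicator f x - (dyad (rhalf p)).indicator f x) := by
    intro x
    have h : ∀ s : Set ℝ, s.indicator f x = f x * s.indicator (fun _ => (1 : ℝ)) x := by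
      intro s
      by_cases hx : x ∈ s <;> simp [hx]
    rw [h, h, haar]
    ring
  simp only [haarCoeff, e]
  rw [integral_const_mul, integral_sub
    ((integrable_indicator_iff (measurableSet_dyad _)).mpr (integrableOn_dyad hf _))
    ((integrable_indicator_iff (measurableSet_dyad _)).mpr (integrableOn_dyad hf _)),
    integral_indicator (measurableSet_dyad _), integral_indicator (measurableSet_dyad _),
    setIntegral_dyad, setIntegral_dyad, len_lhalf, len_rhalf]
  have h0 : 0 < √(len p) := Real.sqrt_pos.mpr (len_pos p)
  have hL : len p = √(len p) * √(len p) := (Real.mul_self_sqrt (len_pos p).le).symm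
  generalize √(len p) = r at *
  rw [hL]
  field_simp

lemma dyad_subset_iff (p q : ℤ × ℤ) : dyad p ⊆ dyad q ↔
    (2 : ℝ) ^ q.1 * q.2 ≤ 2 ^ p.1 * p.2 ∧ (2 : ℝ) ^ p.1 * (p.2 + 1) ≤ 2 ^ q.1 * (q.2 + 1) := by
  apply Set.Ico_subset_Ico_iff
  have : (0 : ℝ) < 2 ^ p.1 := by positivity
  linarith

lemma fst_le_of_dyad_subset {p q : ℤ × ℤ} (h : dyad p ⊆ dyad q) : p.1 ≤ q.1 := by
  rw [dyad_subset_iff] at h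
  have : (2 : ℝ) ^ p.1 ≤ 2 ^ q.1 := by linarith
  exact (zpow_le_zpow_iff_right₀ (by norm_num)).mp this

lemma eq_or_subset_half {p q : ℤ × ℤ} (h : dyad p ⊆ dyad q) :
    p = q ∨ dyad p ⊆ dyad (lhalf q) ∨ dyad p ⊆ dyad (rhalf q) := by
  have hle := fst_le_of_dyad_subset h
  obtain ⟨a, k⟩ := p
  obtain ⟨b, l⟩ := q
  rw [dyad_subset_iff] at h
  simp only [dyad_subset_iff, lhalf, rhalf] at h hle ⊢
  have ha : (0 : ℝ) < 2 ^ a := by positivity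
  rcases hle.eq_or_lt with rfl | hlt
  · left
    have h₁ := le_of_mul_le_mul_left h.1 ha
    have h₂ := le_of_mul_le_mul_left h.2 ha
    norm_cast at h₁ h₂
    simp only [Prod.mk.injEq, true_and]
    omega
  · right
    obtain ⟨m, hm⟩ := Int.le.dest (show a ≤ b - 1 by omega)
    have hb1 : (2 : ℝ) ^ (b - 1) = 2 ^ a * (2 ^ m : ℤ) := by
      rw [← hm, zpow_add₀ (by norm_num)]; simp
    have hb : (2 : ℝ) ^ b = 2 ^ a * ((2 ^ m : ℤ) * 2) := by
      rw [← mul_assoc, ← hb1, zpow_sub_one₀ (by norm_num)]; simp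
    generalize (2 ^ m : ℤ) = M at hb hb1
    rw [hb] at h
    rw [hb1]
    simp only [mul_assoc, mul_le_mul_iff_right₀ ha] at h ⊢
    norm_cast at h ⊢
    rcases le_or_gt (k + 1) (M * (2 * l + 1)) with h' | h'
    · left; constructor <;> nlinarith
    · right; constructor <;> nlinarith

/-- Summing a Bellman-type inequality down the dyadic tree. -/
lemma sum_le_of_superadditive {D G : ℤ × ℤ → ℝ} (hD : ∀ p, 0 ≤ D p) (hG : ∀ p, 0 ≤ G p)
    (h : ∀ p, D p + G (lhalf p) + G (rhalf p) ≤ G p) (n : ℕ) (q : ℤ × ℤ)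
    (S : Finset (ℤ × ℤ)) (hS : ∀ p ∈ S, dyad p ⊆ dyad q ∧ q.1 < p.1 + n) :
    ∑ p ∈ S, D p ≤ G q := by
  classical
  induction n generalizing q S with
  | zero =>
    have : S = ∅ := Finset.eq_empty_of_forall_notMem fun p hp => by
      have h₁ := fst_le_of_dyad_subset (hS p hp).1
      have h₂ := (hS p hp).2
      push_cast at h₂
      omega
    simpa [this] using hG q
  | succ n ih =>
    set L := S.filter fun p => dyad p ⊆ dyad (lhalf q)
    set R := S.filter fun p => dyad p ⊆ dyad (rhalf q)
    have hsub : S ⊆ {q} ∪ (L ∪ R) := by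
      intro p hp
      rcases eq_or_subset_half (hS p hp).1 with h' | h' | h' <;> simp [L, R, hp, h']
    have hL : ∑ p ∈ L, D p ≤ G (lhalf q) := ih _ _ fun p hp => by
      obtain ⟨hp, hp'⟩ := Finset.mem_filter.mp hp
      have h₂ := (hS p hp).2
      push_cast at h₂
      exact ⟨hp', by simp only [lhalf]; omega⟩
    have hR : ∑ p ∈ R, D p ≤ G (rhalf q) := ih _ _ fun p hp => by
      obtain ⟨hp, hp'⟩ := Finset.mem_filter.mp hp
      have h₂ := (hS p hp).2
      push_cast at h₂
      exact ⟨hp', by simp only [rhalf]; omega⟩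
    have hun : ∀ A B : Finset (ℤ × ℤ), ∑ p ∈ A ∪ B, D p ≤ ∑ p ∈ A, D p + ∑ p ∈ B, D p := by
      intro A B
      rw [← Finset.sum_union_inter]
      linarith [Finset.sum_nonneg fun p (_ : p ∈ A ∩ B) => hD p]
    calc ∑ p ∈ S, D p ≤ ∑ p ∈ {q} ∪ (L ∪ R), D p :=
          Finset.sum_le_sum_of_subset_of_nonneg hsub fun p _ _ => hD p
      _ ≤ ∑ p ∈ {q}, D p + (∑ p ∈ L, D p + ∑ p ∈ R, D p) :=
          (hun _ _).trans (add_le_add le_rfl (hun _ _))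
      _ ≤ G q := by
        rw [Finset.sum_singleton]
        linarith [h q]

lemma tsum_ofReal_le_of_superadditive {D G : ℤ × ℤ → ℝ} (hD : ∀ p, 0 ≤ D p)
    (hG : ∀ p, 0 ≤ G p) (h : ∀ p, D p + G (lhalf p) + G (rhalf p) ≤ G p) (q : ℤ × ℤ) :
    ∑' p : {p : ℤ × ℤ // dyad p ⊆ dyad q}, ENNReal.ofReal (D p.1) ≤ ENNReal.ofReal (G q) := by
  rw [ENNReal.tsum_eq_iSup_sum]
  refine iSup_le fun S => ?_
  rw [← ENNReal.ofReal_sum_of_nonneg fun p _ => hD p.1]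
  apply ENNReal.ofReal_le_ofReal
  have e : ∑ p ∈ S, D p.1 = ∑ p ∈ S.map (Function.Embedding.subtype _), D p := by simp
  rw [e]
  refine sum_le_of_superadditive hD hG h
    ((S.sup fun p => (q.1 - p.1.1).toNat) + 1) q _ fun p hp => ?_
  obtain ⟨p, hpS, rfl⟩ := Finset.mem_map.mp hp
  refine ⟨p.2, ?_⟩
  have := Finset.le_sup (f := fun p : {p : ℤ × ℤ // dyad p ⊆ dyad q} => (q.1 - p.1.1).toNat) hpS
  simp only [Function.Embedding.subtype_apply] at *
  omega

/-- The quantity `|I| ⟨u⟩_I ⟨v⟩_I` times the squared relative oscillations of `u` and `v`. -/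
def oscTerm (u v : ℝ → ℝ) (p : ℤ × ℤ) : ℝ :=
  len p * (avg u p * avg v p * (relDiff (avg u (lhalf p)) (avg u (rhalf p)) ^ 2 +
    relDiff (avg v (lhalf p)) (avg v (rhalf p)) ^ 2))

lemma oscTerm_nonneg {u v : ℝ → ℝ} (hu : LocallyIntegrable u volume)
    (hv : LocallyIntegrable v volume) (hu0 : ∀ x, 0 < u x) (hv0 : ∀ x, 0 < v x)
    (p : ℤ × ℤ) : 0 ≤ oscTerm u v p := by
  have := avg_pos hu hu0 p
  have := avg_pos hv hv0 p
  have := len_pos p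
  unfold oscTerm
  positivity

lemma oscTerm_le {u v : ℝ → ℝ} (hu : LocallyIntegrable u volume)
    (hv : LocallyIntegrable v volume) (hu0 : ∀ x, 0 < u x) (hv0 : ∀ x, 0 < v x)
    {R : ℝ} (p : ℤ × ℤ) (hR : √√(avg u p * avg v p) ≤ R) :
    oscTerm u v p ≤ 24 * R ^ 3 * (len p * √√(avg u p * avg v p) -
      len (lhalf p) * √√(avg u (lhalf p) * avg v (lhalf p)) -
      len (rhalf p) * √√(avg u (rhalf p) * avg v (rhalf p))) := by
  rw [len_lhalf, len_rhalf, oscTerm]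
  rw [avg_eq hu p, avg_eq hv p] at hR ⊢
  have h := mul_le_mul_of_nonneg_left (bellman_drop' (avg_pos hu hu0 (lhalf p))
    (avg_pos hu hu0 (rhalf p)) (avg_pos hv hv0 (lhalf p)) (avg_pos hv hv0 (rhalf p)) hR)
    (len_pos p).le
  linarith

lemma abs_haarCoeff_mul_le {u v : ℝ → ℝ} (hu : LocallyIntegrable u volume)
    (hv : LocallyIntegrable v volume) (hu0 : ∀ x, 0 < u x) (hv0 : ∀ x, 0 < v x)
    (p : ℤ × ℤ) :
    |haarCoeff v p * haarCoeff u (lhalf p)| ≤ 4 * (oscTerm u v p + oscTerm u v (lhalf p)) := by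
  have abs_diff : ∀ {a b : ℝ}, 0 < a → 0 < b → |a - b| = 2 * ((a + b) / 2 * |relDiff a b|) := by
    intro a b ha hb
    rw [relDiff, abs_div, abs_of_pos (add_pos ha hb)]
    field_simp
  have huP := avg_pos hu hu0
  have hvP := avg_pos hv hv0
  have hL := len_pos p
  set a := relDiff (avg v (lhalf p)) (avg v (rhalf p)) with ha
  set b := relDiff (avg u (lhalf (lhalf p))) (avg u (rhalf (lhalf p))) with hb
  have hva : avg v p * (1 - |a|) ≤ avg v (lhalf p) := by
    have : avg v p * (1 + a) = avg v (lhalf p) := by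
      rw [avg_eq hv p, ha, relDiff]
      have := hvP (lhalf p)
      have := hvP (rhalf p)
      field_simp
      ring
    rw [← this]
    have := hvP p
    gcongr
    linarith [neg_abs_le a]
  have hul : avg u (lhalf p) ≤ 2 * avg u p := by
    rw [avg_eq hu p]
    linarith [huP (rhalf p)]
  have hmix := mixed_le (huP p).le (hvP p).le (huP (lhalf p)).le (hvP (lhalf p)).le hul
    (abs_nonneg b) (abs_relDiff_le (huP _) (huP _)) hva
  rw [sq_abs, sq_abs] at hmix
  have hsq : √(len p) * √(len p / 2) ≤ len p := by
    calc √(len p) * √(len p / 2) ≤ √(len p) * √(len p) := by gcongr; linarith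
      _ = len p := Real.mul_self_sqrt hL.le
  have hX : |haarCoeff v p * haarCoeff u (lhalf p)| =
      √(len p) * √(len p / 2) * (avg v p * |a| * (avg u (lhalf p) * |b|)) := by
    rw [haarCoeff_eq hv, haarCoeff_eq hu, len_lhalf, abs_mul, abs_mul, abs_mul,
      abs_of_nonneg (by positivity), abs_of_nonneg (a := √(len p / 2) / 2) (by positivity),
      abs_diff (hvP _) (hvP _), abs_diff (huP _) (huP _), ← avg_eq hv, ← avg_eq hu]
    ring
  have h₁ : len p * (avg u p * avg v p * a ^ 2) ≤ oscTerm u v p := by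
    have := huP p
    have := hvP p
    unfold oscTerm
    gcongr
    exact le_add_of_nonneg_left (sq_nonneg _)
  have h₂ : len p / 2 * (avg u (lhalf p) * avg v (lhalf p) * b ^ 2) ≤ oscTerm u v (lhalf p) := by
    have := huP (lhalf p)
    have := hvP (lhalf p)
    unfold oscTerm
    rw [len_lhalf]
    gcongr
    exact le_add_of_nonneg_right (sq_nonneg _)
  have h₃ : 0 ≤ oscTerm u v (lhalf p) := oscTerm_nonneg hu hv hu0 hv0 _
  calc |haarCoeff v p * haarCoeff u (lhalf p)|
      ≤ len p * (avg v p * |a| * (avg u (lhalf p) * |b|)) := by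
        rw [hX]
        have := huP (lhalf p)
        have := hvP p
        gcongr
    _ ≤ len p * (4 * (avg u p * avg v p * a ^ 2) +
          avg u (lhalf p) * avg v (lhalf p) * b ^ 2) := by gcongr
    _ ≤ _ := by linarith

lemma tsum_haarCoeff_le {u v : ℝ → ℝ} (hu : LocallyIntegrable u volume)
    (hv : LocallyIntegrable v volume) (hu0 : ∀ x, 0 < u x) (hv0 : ∀ x, 0 < v x)
    {Q : ℝ} (hQ : ∀ p, avg u p * avg v p ≤ Q) (q : ℤ × ℤ) :
    ∑' p : {p : ℤ × ℤ // dyad p ⊆ dyad q},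
      ENNReal.ofReal |haarCoeff v p.1 * haarCoeff u (lhalf p.1)| ≤
        ENNReal.ofReal (192 * Q * len q) := by
  have hQ0 : 0 ≤ Q := (mul_pos (avg_pos hu hu0 q) (avg_pos hv hv0 q)).le.trans (hQ q)
  set R := √√Q with hRdef
  have hR0 : 0 ≤ R := by positivity
  have hR4 : R ^ 4 = Q := by
    have h : R ^ 4 = (R ^ 2) ^ 2 := by ring
    rw [h, hRdef, Real.sq_sqrt (by positivity), Real.sq_sqrt hQ0]
  have hR : ∀ p, √√(avg u p * avg v p) ≤ R := fun p =>
    Real.sqrt_le_sqrt (Real.sqrt_le_sqrt (hQ p))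
  set B : ℤ × ℤ → ℝ := fun p => len p * √√(avg u p * avg v p) with hB
  have hB0 : ∀ p, 0 ≤ B p := fun p => mul_nonneg (len_pos p).le (Real.sqrt_nonneg _)
  have hBR : ∀ p, B p ≤ len p * R := fun p => mul_le_mul_of_nonneg_left (hR p) (len_pos p).le
  have hdrop : ∀ p, oscTerm u v p ≤ 24 * R ^ 3 * (B p - B (lhalf p) - B (rhalf p)) :=
    fun p => oscTerm_le hu hv hu0 hv0 p (hR p)
  refine (tsum_ofReal_le_of_superadditive
    (D := fun p => |haarCoeff v p * haarCoeff u (lhalf p)|)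
    (G := fun p => 96 * R ^ 3 * (B p + (B (lhalf p) + B (rhalf p))))
    (fun p => abs_nonneg _) (fun p => ?_)
    (fun p => ?_) q).trans (ENNReal.ofReal_le_ofReal ?_)
  · have := hB0 p
    have := hB0 (lhalf p)
    have := hB0 (rhalf p)
    positivity
  · have := abs_haarCoeff_mul_le hu hv hu0 hv0 p
    have := hdrop p
    have := hdrop (lhalf p)
    have := hdrop (rhalf p)
    have := oscTerm_nonneg hu hv hu0 hv0 (rhalf p)
    linarith
  · have h₁ := hBR q
    have h₂ := hBR (lhalf q)
    have h₃ := hBR (rhalf q)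
    rw [len_lhalf] at h₂
    rw [len_rhalf] at h₃
    calc 96 * R ^ 3 * (B q + (B (lhalf q) + B (rhalf q)))
        ≤ 96 * R ^ 3 * (2 * (len q * R)) := by gcongr; linarith
      _ = 192 * Q * len q := by rw [← hR4]; ring

/-- `∑_{I ⊆ J} |⟨ω⁻¹, h_I⟩ ⟨ω, h_{I₋}⟩| ≤ C [ω]_{A₂} |J|`. -/
theorem statement8 :
    ∃ C : ℝ≥0, ∀ ω : ℝ → ℝ, IsWeight ω → A2 ω < ⊤ → ∀ q : ℤ × ℤ,
      ∑' p : {p : ℤ × ℤ // dyad p ⊆ dyad q},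
          ENNReal.ofReal (|haarCoeff (fun x => (ω x)⁻¹) p.1 * haarCoeff ω (lhalf p.1)|) ≤
        (C : ℝ≥0∞) * A2 ω * ENNReal.ofReal (len q) := by
  refine ⟨192, fun ω ⟨_, hpos, hω, hσ⟩ hA q => ?_⟩
  have hQ : ∀ p, avg ω p * avg (fun x => (ω x)⁻¹) p ≤ (A2 ω).toReal := fun p =>
    (ENNReal.ofReal_le_iff_le_toReal hA.ne).mp
      (le_iSup (fun p => ENNReal.ofReal (avg ω p * avg (fun x => (ω x)⁻¹) p)) p)
  refine (tsum_haarCoeff_le hω hσ hpos (fun x => inv_pos.mpr (hpos x)) hQ q).trans_eq ?_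
  rw [ENNReal.ofReal_mul (by positivity), ENNReal.ofReal_mul (by norm_num),
    ENNReal.ofReal_toReal hA.ne]
  simp
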